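/- For every natural number k, the graph G_k has exactly two robust maximal independent sets, namely M1 = {α_i, γ_i, b_i : 0 ≤ i ≤ k} and M2 = {a_i, c_i, β_i : 0 ≤ i ≤ k}: every robust MIS of G_k equals M1 or M2. -/

import Mathlib

/-- A set of vertices is independent in `G` if no two of its members are adjacent. -/
def IsIndep {V : Type*} (G : SimpleGraph V) (M : Set V) : Prop :=
  ∀ ⦃u⦄, u ∈ M → ∀ ⦃v⦄, v ∈ M → ¬ G.Adj u v

/-- A maximal independent set of `G`: independent and maximal w.r.t. inclusion among
independent sets of `G`. -/
def IsMIS {V : Type*} (G : SimpleGraph V) (M : Set V) : Prop :=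
  IsIndep G M ∧ ∀ S : Set V, IsIndep G S → M ⊆ S → S = M

/-- A robust MIS of `G`: an MIS of `G` that remains a maximal independent set in every
connected spanning subgraph of `G` (a spanning subgraph being a graph on the same vertex
set whose edge set is contained in that of `G`). -/
def IsRobustMIS {V : Type*} (G : SimpleGraph V) (M : Set V) : Prop :=
  IsMIS G M ∧ ∀ H : SimpleGraph V, H ≤ G → H.Connected → IsMIS H M

/-- Vertices of the graph `G_k`: six families `a_i, b_i, c_i, α_i, β_i, γ_i` for `0 ≤ i ≤ k`. -/
inductive GV (k : ℕ) : Type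
  | a : Fin (k + 1) → GV k
  | b : Fin (k + 1) → GV k
  | c : Fin (k + 1) → GV k
  | al : Fin (k + 1) → GV k  -- α
  | be : Fin (k + 1) → GV k  -- β
  | ga : Fin (k + 1) → GV k  -- γ
  deriving DecidableEq

/-- Base relation generating the edges of `G_k`: the 6-cycle
`a₀–b₀–c₀–γ₀–β₀–α₀–a₀` of `G₀`, and for each `1 ≤ i ≤ k` the edges
`{β_{i-1},α_i}, {β_{i-1},γ_i}, {α_i,β_i}, {γ_i,β_i}, {b_{i-1},a_i}, {b_{i-1},c_i},
{a_i,b_i}, {c_i,b_i}`. -/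
def gkRel (k : ℕ) : GV k → GV k → Prop
  | GV.a i, GV.b j => i = j ∨ (i : ℕ) = (j : ℕ) + 1      -- a_i–b_i and b_{i-1}–a_i
  | GV.b i, GV.c j => i = j ∨ (j : ℕ) = (i : ℕ) + 1      -- b_i–c_i and b_{i-1}–c_i
  | GV.al i, GV.be j => i = j ∨ (i : ℕ) = (j : ℕ) + 1    -- α_i–β_i and β_{i-1}–α_i
  | GV.be i, GV.ga j => i = j ∨ (j : ℕ) = (i : ℕ) + 1    -- β_i–γ_i and β_{i-1}–γ_i
  | GV.c i, GV.ga j => i = 0 ∧ j = 0                     -- c₀–γ₀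
  | GV.al i, GV.a j => i = 0 ∧ j = 0                     -- α₀–a₀
  | _, _ => False

/-- The graph `G_k`. -/
def Gk (k : ℕ) : SimpleGraph (GV k) := SimpleGraph.fromRel (gkRel k)

/-- The set `M1 = {α_i, γ_i, b_i : 0 ≤ i ≤ k}`. -/
def M1 (k : ℕ) : Set (GV k) :=
  {v | ∃ i : Fin (k + 1), v = GV.al i ∨ v = GV.ga i ∨ v = GV.b i}

/-- The set `M2 = {a_i, c_i, β_i : 0 ≤ i ≤ k}`. -/
def M2 (k : ℕ) : Set (GV k) :=
  {v | ∃ i : Fin (k + 1), v = GV.a i ∨ v = GV.c i ∨ v = GV.be i}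

theorem IsMIS.exists_adj {V : Type*} {G : SimpleGraph V} {M : Set V} (h : IsMIS G M) {v : V}
    (hv : v ∉ M) : ∃ w ∈ M, G.Adj v w := by
  by_contra! hn
  have hi : IsIndep G (insert v M) := by
    rintro x (rfl | hx) y (rfl | hy)
    · exact G.irrefl
    · exact hn y hy
    · exact fun hxy => hn x hx hxy.symm
    · exact h.1 hx hy
  exact hv (h.2 _ hi (Set.subset_insert v M) ▸ Set.mem_insert v M)

theorem isMIS_of_exists_adj {V : Type*} {G : SimpleGraph V} {M : Set V} (h : IsIndep G M)
    (hd : ∀ v ∉ M, ∃ w ∈ M, G.Adj v w) : IsMIS G M := by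
  refine ⟨h, fun S hS hMS => Set.Subset.antisymm (fun v hv => ?_) hMS⟩
  by_contra hvM
  obtain ⟨w, hw, hvw⟩ := hd v hvM
  exact hS hv (hMS hw) hvw

/-- Each colour class of a connected nontrivial bipartite graph is a robust MIS. -/
theorem isRobustMIS_of_adj_iff {V : Type*} [Nontrivial V] {G : SimpleGraph V}
    (hG : G.Connected) {M : Set V} (h : ∀ u v, G.Adj u v → (u ∈ M ↔ v ∉ M)) :
    IsRobustMIS G M := by
  have key : ∀ H : SimpleGraph V, H ≤ G → H.Connected → IsMIS H M := by
    intro H hH hc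
    refine isMIS_of_exists_adj (fun u hu v hv huv => (h u v (hH huv)).1 hu hv) fun v hv => ?_
    obtain ⟨w, hw⟩ := hc.preconnected.exists_adj_of_nontrivial v
    exact ⟨w, by_contra fun hwM => hv ((h v w (hH hw)).2 hwM), hw⟩
  exact ⟨key G le_rfl hG, key⟩

/-- In a bridgeless graph, if a vertex `v` outside a robust MIS has at most two neighbours, then
all its neighbours are in the MIS. -/
theorem IsRobustMIS.mem_of_adj {V : Type*} {G : SimpleGraph V} (hG : G.Connected)
    (hb : ∀ ⦃u v⦄, G.Adj u v → ¬ G.IsBridge s(u, v)) {M : Set V} (hM : IsRobustMIS G M) {v x : V}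
    (hv : v ∉ M) (hx : G.Adj v x)
    (hn : ∀ y w, G.Adj v y → x ≠ y → G.Adj v w → w = x ∨ w = y) : x ∈ M := by
  by_contra hxM
  obtain ⟨y, hyM, hy⟩ := hM.1.exists_adj hv
  obtain ⟨w, hwM, hw⟩ := (hM.2 _ (G.deleteEdges_le {s(v, y)})
    (hG.connected_delete_edge_of_not_isBridge (hb hy))).exists_adj hv
  rw [SimpleGraph.deleteEdges_adj] at hw
  rcases hn y w hy (fun h => hxM (h ▸ hyM)) hw.1 with rfl | rfl
  · exact hxM hwM
  · exact hw.2 rfl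

namespace Gk

variable {k : ℕ}

theorem adj_a_b (i j : Fin (k + 1)) :
    (Gk k).Adj (.a i) (.b j) ↔ i = j ∨ (i : ℕ) = (j : ℕ) + 1 := by
  simp [Gk, gkRel]

theorem adj_b_c (i j : Fin (k + 1)) :
    (Gk k).Adj (.b i) (.c j) ↔ i = j ∨ (j : ℕ) = (i : ℕ) + 1 := by
  simp [Gk, gkRel]

theorem adj_al_be (i j : Fin (k + 1)) :
    (Gk k).Adj (.al i) (.be j) ↔ i = j ∨ (i : ℕ) = (j : ℕ) + 1 := by
  simp [Gk, gkRel]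

theorem adj_be_ga (i j : Fin (k + 1)) :
    (Gk k).Adj (.be i) (.ga j) ↔ i = j ∨ (j : ℕ) = (i : ℕ) + 1 := by
  simp [Gk, gkRel]

theorem adj_c_ga (i j : Fin (k + 1)) : (Gk k).Adj (.c i) (.ga j) ↔ i = 0 ∧ j = 0 := by
  simp [Gk, gkRel]

theorem adj_al_a (i j : Fin (k + 1)) : (Gk k).Adj (.al i) (.a j) ↔ i = 0 ∧ j = 0 := by
  simp [Gk, gkRel]

theorem connected (k : ℕ) : (Gk k).Connected := by
  have hab (i : Fin (k + 1)) := ((adj_a_b i i).2 (.inl rfl)).reachable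
  have hbc (i : Fin (k + 1)) := ((adj_b_c i i).2 (.inl rfl)).reachable
  have hαβ (i : Fin (k + 1)) := ((adj_al_be i i).2 (.inl rfl)).reachable
  have hβγ (i : Fin (k + 1)) := ((adj_be_ga i i).2 (.inl rfl)).reachable
  have hαa := ((adj_al_a (k := k) 0 0).2 ⟨rfl, rfl⟩).reachable
  have hb (i : Fin (k + 1)) : (Gk k).Reachable (.b 0) (.b i) := by
    induction i using Fin.induction with
    | zero => rfl
    | succ i ih =>
      exact (ih.trans ((adj_a_b i.succ i.castSucc).2 (.inr (by simp))).reachable.symm).trans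
        (hab i.succ)
  have hβ (i : Fin (k + 1)) : (Gk k).Reachable (.b 0) (.be i) := by
    induction i using Fin.induction with
    | zero => exact ((hab 0).symm.trans hαa.symm).trans (hαβ 0)
    | succ i ih =>
      exact (ih.trans ((adj_al_be i.succ i.castSucc).2 (.inr (by simp))).reachable.symm).trans
        (hαβ i.succ)
  rw [SimpleGraph.connected_iff_exists_forall_reachable]
  refine ⟨.b 0, ?_⟩
  rintro (i | i | i | i | i | i)
  · exact (hb i).trans (hab i).symm
  · exact hb i
  · exact (hb i).trans (hbc i)
  · exact (hβ i).trans (hαβ i).symm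
  · exact hβ i
  · exact (hβ i).trans (hβγ i)

open SimpleGraph.Walk in
theorem not_isBridge {u v : GV k} (h : (Gk k).Adj u v) : ¬ (Gk k).IsBridge s(u, v) := by
  have hexagon : ∀ e ∈ [s(GV.a 0, GV.b 0), s(GV.b 0, GV.c 0), s(GV.c 0, GV.ga 0),
      s(GV.ga 0, GV.be 0), s(GV.be 0, GV.al 0), s(GV.al 0, GV.a 0)], ¬ (Gk k).IsBridge e :=
    fun e he hb => hb.notMem_edges_of_isCycle
      (p := cons ((adj_a_b 0 0).2 (.inl rfl)) <| cons ((adj_b_c 0 0).2 (.inl rfl)) <|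
        cons ((adj_c_ga 0 0).2 ⟨rfl, rfl⟩) <| cons ((adj_be_ga 0 0).2 (.inl rfl)).symm <|
        cons ((adj_al_be 0 0).2 (.inl rfl)).symm <| cons ((adj_al_a 0 0).2 ⟨rfl, rfl⟩) nil)
      (by simp [isCycle_def, isTrail_def]) he
  have square_b (i : Fin k) : ∀ e ∈ [s(GV.a i.succ, GV.b i.succ), s(GV.b i.succ, GV.c i.succ),
      s(GV.c i.succ, GV.b i.castSucc), s(GV.b i.castSucc, GV.a i.succ)],
      ¬ (Gk k).IsBridge e :=
    fun e he hb => hb.notMem_edges_of_isCycle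
      (p := cons ((adj_a_b i.succ i.succ).2 (.inl rfl)) <|
        cons ((adj_b_c i.succ i.succ).2 (.inl rfl)) <|
        cons ((adj_b_c i.castSucc i.succ).2 (.inr (by simp))).symm <|
        cons ((adj_a_b i.succ i.castSucc).2 (.inr (by simp))).symm nil)
      (by simp [isCycle_def, isTrail_def, Fin.ext_iff]) (by simpa using he)
  have square_be (i : Fin k) : ∀ e ∈ [s(GV.al i.succ, GV.be i.succ),
      s(GV.be i.succ, GV.ga i.succ), s(GV.ga i.succ, GV.be i.castSucc),
      s(GV.be i.castSucc, GV.al i.succ)], ¬ (Gk k).IsBridge e :=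
    fun e he hb => hb.notMem_edges_of_isCycle
      (p := cons ((adj_al_be i.succ i.succ).2 (.inl rfl)) <|
        cons ((adj_be_ga i.succ i.succ).2 (.inl rfl)) <|
        cons ((adj_be_ga i.castSucc i.succ).2 (.inr (by simp))).symm <|
        cons ((adj_al_be i.succ i.castSucc).2 (.inr (by simp))).symm nil)
      (by simp [isCycle_def, isTrail_def, Fin.ext_iff]) (by simpa using he)
  have square (i : Fin k) (e) (he : e ∈ [s(GV.a i.succ, GV.b i.succ),
      s(GV.b i.succ, GV.c i.succ), s(GV.c i.succ, GV.b i.castSucc),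
      s(GV.b i.castSucc, GV.a i.succ)] ++ [s(GV.al i.succ, GV.be i.succ),
      s(GV.be i.succ, GV.ga i.succ), s(GV.ga i.succ, GV.be i.castSucc),
      s(GV.be i.castSucc, GV.al i.succ)]) : ¬ (Gk k).IsBridge e :=
    (List.mem_append.1 he).elim (square_b i e) (square_be i e)
  have h_rel (u v : GV k) (h : gkRel k u v) : ¬ (Gk k).IsBridge s(u, v) := by
    rcases u with i | i | i | i | i | i <;> rcases v with j | j | j | j | j | j <;>
      simp only [gkRel] at h
    all_goals
      first
      | (obtain ⟨rfl, rfl⟩ := And.intro h.1 h.2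
         exact hexagon _ (by simp))
      | (rcases h with rfl | h
         · induction i using Fin.cases with
           | zero => exact hexagon _ (by simp)
           | succ i => exact square i _ (by simp)
         · induction i using Fin.cases with
           | zero => simp at h
           | succ i =>
             obtain rfl : j = i.castSucc := Fin.ext (by simpa using h.symm)
             exact square i _ (by simp))
      | (rcases h with rfl | h
         · induction i using Fin.cases with
           | zero => exact hexagon _ (by simp)
           | succ i => exact square i _ (by simp)
         · induction j using Fin.cases with
           | zero => simp at h
           | succ j =>
             obtain rfl : i = j.castSucc := Fin.ext (by simpa using h.symm)
             exact square j _ (by simp))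
  rcases h with ⟨-, h | h⟩
  · exact h_rel u v h
  · exact Sym2.eq_swap ▸ h_rel v u h

/-- The vertices outside the `b` and `β` families have at most two neighbours. -/
theorem eq_or_eq_of_adj {v x y w : GV k} (hb : ∀ i, v ≠ .b i) (hβ : ∀ i, v ≠ .be i)
    (hx : (Gk k).Adj v x) (hy : (Gk k).Adj v y) (hxy : x ≠ y) (hw : (Gk k).Adj v w) :
    w = x ∨ w = y := by
  simp only [Gk, SimpleGraph.fromRel_adj] at hx hy hw
  rcases v with i | i | i | i | i | i
  case b => exact absurd rfl (hb i)
  case be => exact absurd rfl (hβ i)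
  all_goals
    rcases x with j | j | j | j | j | j <;> simp [gkRel] at hx <;>
    rcases y with l | l | l | l | l | l <;> simp [gkRel] at hy <;>
    rcases w with m | m | m | m | m | m <;> simp [gkRel] at hw <;>
    grind

theorem mem_M2 (v : GV k) : v ∈ M2 k ↔ v ∉ M1 k := by
  cases v <;> simp [M1, M2]

theorem mem_M1_iff_of_adj {u v : GV k} (h : (Gk k).Adj u v) : u ∈ M1 k ↔ v ∉ M1 k := by
  have h_rel (u v : GV k) (h : gkRel k u v) : u ∈ M1 k ↔ v ∉ M1 k := by
    cases u <;> cases v <;> simp_all [gkRel, M1]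
  rcases h with ⟨-, h | h⟩
  · exact h_rel u v h
  · have := h_rel v u h
    tauto

/-- Every edge of `G_k` has exactly one endpoint in a given robust MIS. -/
theorem mem_iff_of_isRobustMIS {M : Set (GV k)} (hM : IsRobustMIS (Gk k) M) {u v : GV k}
    (h : (Gk k).Adj u v) : u ∈ M ↔ v ∉ M := by
  refine ⟨fun hu hv => hM.1.1 hu hv h, fun hv => by_contra fun hu => ?_⟩
  have mem {u v : GV k} (h : (Gk k).Adj u v) (hu : u ∉ M) (hb : ∀ i, u ≠ .b i)
      (hβ : ∀ i, u ≠ .be i) : v ∈ M :=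
    hM.mem_of_adj (connected k) (fun _ _ => not_isBridge) hu h
      fun _ _ hy hxy hw => eq_or_eq_of_adj hb hβ h hy hxy hw
  by_cases hd : (∀ i, u ≠ .b i) ∧ ∀ i, u ≠ .be i
  · exact hv (mem h hu hd.1 hd.2)
  · refine hu (mem h.symm hv ?_ ?_) <;> rintro i rfl <;> cases u <;> simp_all [Gk, gkRel]

instance : Nontrivial (GV k) := ⟨.a 0, .b 0, by simp⟩

end Gk

theorem stmt_10 (k : ℕ) :
    IsRobustMIS (Gk k) (M1 k) ∧ IsRobustMIS (Gk k) (M2 k) ∧ M1 k ≠ M2 k ∧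
      ∀ M : Set (GV k), IsRobustMIS (Gk k) M → M = M1 k ∨ M = M2 k := by
  refine ⟨isRobustMIS_of_adj_iff (Gk.connected k) fun _ _ => Gk.mem_M1_iff_of_adj,
    isRobustMIS_of_adj_iff (Gk.connected k) fun u v h => ?_, fun h => ?_, fun M hM => ?_⟩
  · rw [Gk.mem_M2, Gk.mem_M2, Gk.mem_M1_iff_of_adj h]
  · have := Gk.mem_M2 (k := k) (.a 0)
    rw [← h] at this
    tauto
  · have key (u v : GV k) : (u ∈ M ↔ u ∈ M1 k) ↔ (v ∈ M ↔ v ∈ M1 k) := by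
      obtain ⟨p⟩ := (Gk.connected k).preconnected u v
      induction p with
      | nil => rfl
      | cons h _ ih =>
        rw [← ih, Gk.mem_iff_of_isRobustMIS hM h, Gk.mem_M1_iff_of_adj h, not_iff_not]
    by_cases h : GV.a 0 ∈ M ↔ GV.a 0 ∈ M1 k
    · exact .inl (Set.ext fun v => (key v _).2 h)
    · refine .inr (Set.ext fun v => ?_)
      have := key v (.a 0)
      rw [Gk.mem_M2]
      tauto
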